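/- arXiv:2009.11552 — 3 statements merged into one kernel-verified Lean document; each statement's English description precedes it below -/
import Mathlib

section
/- Let G = (V, E, w) be a weighted undirected graph with distinct edge weights, let F be any forest that is a subgraph of G, and let T be a minimum spanning forest of G. Then every edge of T is F-light. -/
open SimpleGraph

variable {V : Type*}

-- The total weight of the edges of a graph.
open Classical in
noncomputable def weightSum [Fintype V] [DecidableEq V] (F : SimpleGraph V)
    (w : Sym2 V → ℝ) : ℝ :=
  ∑ e : Sym2 V, if e ∈ F.edgeSet then w e else 0

/-- `F` is a spanning forest of `G`: a subgraph of `G` which is a forest and contains a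
spanning tree of every connected component of `G` (equivalently, it has the same
reachability relation as `G`). -/
def IsSpanningForest (G F : SimpleGraph V) : Prop :=
  F ≤ G ∧ F.IsAcyclic ∧ ∀ x y : V, F.Reachable x y ↔ G.Reachable x y

/-- `F` is a minimum spanning forest of `G` with respect to the weights `w`. -/
def IsMSF [Fintype V] [DecidableEq V] (G : SimpleGraph V) (w : Sym2 V → ℝ)
    (F : SimpleGraph V) : Prop :=
  IsSpanningForest G F ∧
    ∀ F' : SimpleGraph V, IsSpanningForest G F' → weightSum F w ≤ weightSum F' w

/-- The edge weights of `G` are pairwise distinct. -/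
def DistinctWeights (G : SimpleGraph V) (w : Sym2 V → ℝ) : Prop :=
  ∀ e₁ ∈ G.edgeSet, ∀ e₂ ∈ G.edgeSet, w e₁ = w e₂ → e₁ = e₂

/-- The edge `uv` is `F`-light: either `u, v` are in different components of `F`
(i.e. `w_F(u, v) = ∞`), or its weight is at most the maximum weight of an edge on the
(unique, as `F` is a forest) path from `u` to `v` in `F`. -/
def FLight (F : SimpleGraph V) (w : Sym2 V → ℝ) (u v : V) : Prop :=
  ¬ F.Reachable u v ∨
    ∀ p : F.Walk u v, p.IsPath → ∃ e ∈ p.edges, w s(u, v) ≤ w e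

/-- Deleting an edge `uv`: everything reachable from `u` stays reachable from `u` or `v`. -/
theorem reachable_delete_or (T : SimpleGraph V) (u v y : V) (h : T.Reachable u y) :
    (T.deleteEdges {s(u, v)}).Reachable u y ∨ (T.deleteEdges {s(u, v)}).Reachable v y := by
  rw [SimpleGraph.reachable_iff_reflTransGen] at h
  induction h with
  | refl => exact Or.inl (Reachable.refl _)
  | @tail b c _ hbc ih =>
    by_cases he : s(b, c) = s(u, v)
    · rcases Sym2.eq_iff.1 he with ⟨_, rfl⟩ | ⟨_, rfl⟩
      · exact Or.inr (Reachable.refl _)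
      · exact Or.inl (Reachable.refl _)
    · have h1 : (T.deleteEdges {s(u, v)}).Adj b c := by
        rw [deleteEdges_adj]
        exact ⟨hbc, by simpa using he⟩
      exact ih.imp (fun h => h.trans h1.reachable) (fun h => h.trans h1.reachable)

/-- Reachability transfers when every edge is reachable. -/
theorem reachable_of_adj_reachable (T H : SimpleGraph V)
    (hH : ∀ a b, T.Adj a b → H.Reachable a b) (x y : V) (h : T.Reachable x y) :
    H.Reachable x y := by
  rw [SimpleGraph.reachable_iff_reflTransGen] at h
  induction h with
  | refl => exact Reachable.refl _
  | tail _ hbc ih => exact ih.trans (hH _ _ hbc)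

/-- Weight change under an edge exchange. -/
theorem weightSum_exchange [Fintype V] [DecidableEq V] (T : SimpleGraph V) (w : Sym2 V → ℝ)
    (u v x y : V) (huv : T.Adj u v) (hxy : x ≠ y)
    (hn : ¬ (T.deleteEdges {s(u, v)}).Adj x y) :
    weightSum (T.deleteEdges {s(u, v)} ⊔ edge x y) w
      = weightSum T w - w s(u, v) + w s(x, y) := by
  classical
  have h1 : w s(u, v) = ∑ e : Sym2 V, if e = s(u, v) then w e else 0 := by simp
  have h2 : w s(x, y) = ∑ e : Sym2 V, if e = s(x, y) then w e else 0 := by simp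
  rw [h1, h2]
  unfold weightSum
  rw [← Finset.sum_sub_distrib, ← Finset.sum_add_distrib]
  refine Finset.sum_congr rfl fun e _ => ?_
  have hm : e ∈ (T.deleteEdges {s(u, v)} ⊔ edge x y).edgeSet ↔
      (e ∈ T.edgeSet ∧ e ≠ s(u, v)) ∨ e = s(x, y) := by
    rw [edgeSet_sup, edgeSet_deleteEdges, edgeSet_edge_of_ne hxy]
    simp [or_comm]
  have huv' : s(u, v) ∈ T.edgeSet := huv
  have hn' : ¬ (s(x, y) ∈ T.edgeSet ∧ s(x, y) ≠ s(u, v)) := by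
    rw [deleteEdges_adj] at hn
    simpa using hn
  simp only [hm]
  by_cases a : e = s(x, y)
  · by_cases b : e = s(u, v)
    · have : e ∈ T.edgeSet := b ▸ huv'
      rw [if_pos (Or.inr a), if_pos this, if_pos b, if_pos a]; ring
    · have : e ∉ T.edgeSet := fun h => hn' (a ▸ ⟨h, b⟩)
      rw [if_pos (Or.inr a), if_neg this, if_neg b, if_pos a]; ring
  · by_cases b : e = s(u, v)
    · have : e ∈ T.edgeSet := b ▸ huv'
      rw [if_neg (by tauto), if_pos this, if_pos b, if_neg a]; ring
    · simp [a, b]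

/-- Every edge of a minimum spanning forest `T` of `G` is `F`-light, for any forest
`F` which is a subgraph of `G`. -/
theorem msf_edges_are_FLight [Fintype V] [DecidableEq V]
    (G F T : SimpleGraph V) (w : Sym2 V → ℝ)
    (hw : DistinctWeights G w) (hFG : F ≤ G) (hF : F.IsAcyclic)
    (hT : IsMSF G w T) :
    ∀ u v : V, T.Adj u v → FLight F w u v := by
  intro u v huv
  refine Or.inr fun p _ => ?_
  by_contra! hlt
  obtain ⟨⟨hTG, hTac, hTr⟩, hmin⟩ := hT
  have hnr : ¬ (T.deleteEdges {s(u, v)}).Reachable u v :=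
    isBridge_iff.1 (isAcyclic_iff_forall_adj_isBridge.1 hTac huv)
  obtain ⟨⟨⟨x, y⟩, hFxy⟩, hd, hx, hy⟩ :=
    p.exists_boundary_dart {z | (T.deleteEdges {s(u, v)}).Reachable u z} (Reachable.refl _) hnr
  simp only [Set.mem_setOf_eq] at hx hy
  have hFxy' : F.Adj x y := hFxy
  have hwxy : w s(x, y) < w s(u, v) := hlt _ (List.mem_map.2 ⟨_, hd, rfl⟩)
  have hnxy : ¬ (T.deleteEdges {s(u, v)}).Reachable x y := fun h => hy (hx.trans h)
  have hGuy : G.Reachable u y :=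
    (hx.mono ((deleteEdges_le _).trans hTG)).trans (hFG hFxy').reachable
  have hvy : (T.deleteEdges {s(u, v)}).Reachable v y :=
    (reachable_delete_or T u v y ((hTr _ _).2 hGuy)).resolve_left hy
  have hle : T.deleteEdges {s(u, v)} ≤ T.deleteEdges {s(u, v)} ⊔ edge x y := le_sup_left
  have hexy : (T.deleteEdges {s(u, v)} ⊔ edge x y).Adj x y := by
    rw [sup_adj, edge_adj]
    exact Or.inr ⟨Or.inl ⟨rfl, rfl⟩, hFxy'.ne⟩
  have huv2 : (T.deleteEdges {s(u, v)} ⊔ edge x y).Reachable u v :=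
    ((hx.mono hle).trans hexy.reachable).trans (hvy.mono hle).symm
  have hleG : T.deleteEdges {s(u, v)} ⊔ edge x y ≤ G := by
    refine sup_le ((deleteEdges_le _).trans hTG) ?_
    intro a b hab
    rw [edge_adj] at hab
    rcases hab.1 with ⟨rfl, rfl⟩ | ⟨rfl, rfl⟩
    · exact hFG hFxy'
    · exact (hFG hFxy').symm
  have hsf : IsSpanningForest G (T.deleteEdges {s(u, v)} ⊔ edge x y) := by
    refine ⟨hleG, .sup_edge_of_not_reachable hnxy (hTac.anti (deleteEdges_le _)), fun a b =>
      ⟨fun h => h.mono hleG, fun h => ?_⟩⟩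
    refine reachable_of_adj_reachable T _ (fun c d hcd => ?_) a b ((hTr a b).2 h)
    by_cases he : s(c, d) = s(u, v)
    · rcases Sym2.eq_iff.1 he with ⟨rfl, rfl⟩ | ⟨rfl, rfl⟩
      · exact huv2
      · exact huv2.symm
    · have h1 : (T.deleteEdges {s(u, v)}).Adj c d := by
        rw [deleteEdges_adj]
        exact ⟨hcd, by simpa using he⟩
      exact (hle h1).reachable
  have h := hmin _ hsf
  rw [weightSum_exchange T w u v x y huv hFxy'.ne (fun h => hnxy h.reachable)] at h
  linarith
end

section
/- Let G be a connected weighted undirected graph with distinct edge weights and maximum degree at most 3, let T be its (unique) minimum spanning tree, let π be an injective rank function on the vertices, and let R be the threep defined by T and π, with R_v the subtree of R rooted at v. Consider the Prim search started at a vertex v that repeatedly adds the minimum-weight edge leaving the currently explored set, stopping as soon as either v's whole component has been explored or it adds an edge reaching a vertex u with π(u) < π(v). Then every vertex visited by this search, other than possibly the final lower-rank vertex u, lies in R_v; consequently, the number of queries made by the search (one query per explored vertex, each retrieving that vertex's at most 3 incident edges) is at most C·|R_v| for an absolute constant C. -/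
open SimpleGraph

variable {V : Type*}

/-- A rooted tree on the vertex set `V`, given by its root and parent map
(with the convention that the parent of the root is the root itself); every vertex
reaches the root by iterating the parent map. -/
structure RTree (V : Type*) where
  root : V
  parent : V → V
  parent_root : parent root = root
  reaches_root : ∀ v : V, ∃ k : ℕ, parent^[k] v = root

/-- The vertex set of the subtree of `R` rooted at `v`. -/
def RTree.subtree (R : RTree V) (v : V) : Set V :=
  {u | ∃ k : ℕ, R.parent^[k] u = v}

/-- The depth of a vertex: the number of nodes on the path from `v` to the root. -/
noncomputable def RTree.depth (R : RTree V) (v : V) : ℕ :=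
  sInf {k : ℕ | R.parent^[k] v = R.root} + 1

/-- The height of a rooted tree: the maximum number of nodes on a root-to-leaf path. -/
noncomputable def RTree.height [Fintype V] (R : RTree V) : ℕ :=
  Finset.univ.sup R.depth

/-- `j` is an ancestor of `i` in `R` (lies on the path from `i` to the root). -/
def RTree.ancestor (R : RTree V) (i j : V) : Prop :=
  ∃ k : ℕ, R.parent^[k] i = j

/-- `u` and `w` are joined by a walk of `T` all of whose vertices lie in `s`. -/
def ReachIn (T : SimpleGraph V) (s : Set V) (u w : V) : Prop :=
  ∃ p : T.Walk u w, ∀ x ∈ p.support, x ∈ s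

/-- The family of vertex sets of connected components of the subgraph of `T`
induced by `s`. -/
def compSets (T : SimpleGraph V) (s : Set V) : Set (Set V) :=
  {S | ∃ u ∈ s, S = {w | ReachIn T s u w}}

/-- The family of vertex sets of the subtrees rooted at the children of `v` in `R`. -/
def childSubtrees (R : RTree V) (v : V) : Set (Set V) :=
  {S | ∃ c : V, R.parent c = v ∧ c ≠ v ∧ S = R.subtree c}

/-- `R` is the threep of the tree `T` with respect to the injective rank function `π`:
(i) every vertex has minimum rank in its subtree (min-heap), and (ii) for every vertex
`v`, the vertex sets of the subtrees rooted at the children of `v` are exactly the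
connected components of the subgraph of `T` induced by `R_v \ {v}`. -/
def IsThreep (T : SimpleGraph V) (π : V → ℕ) (R : RTree V) : Prop :=
  (∀ v : V, ∀ u ∈ R.subtree v, π v ≤ π u) ∧
  (∀ v : V, childSubtrees R v = compSets T (R.subtree v \ {v}))

/-- The maximum degree of `T` is at most `d`. -/
def MaxDegLE (T : SimpleGraph V) (d : ℕ) : Prop :=
  ∀ v : V, {u | T.Adj v u}.ncard ≤ d

/-- A single step of Prim's algorithm: `u` is the new endpoint of the minimum-weight
edge of `G` with exactly one endpoint in the explored set `S`. -/
def IsPrimStep (G : SimpleGraph V) (w : Sym2 V → ℝ) (S : Set V) (u : V) : Prop :=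
  u ∉ S ∧ ∃ x ∈ S, G.Adj x u ∧
    ∀ y ∈ S, ∀ z : V, z ∉ S → G.Adj y z → w s(x, u) ≤ w s(y, z)

/-- `L` is the list of vertices explored, in order, by a run of Prim's algorithm. -/
inductive PrimRun (G : SimpleGraph V) (w : Sym2 V → ℝ) : List V → Prop
  | single (v : V) : PrimRun G w [v]
  | step {L : List V} {u : V} : PrimRun G w L →
      IsPrimStep G w {x | x ∈ L} u → PrimRun G w (L ++ [u])

/-- `L` is the complete trace of the Prim search started at `v` with respect to the
ranking `π`: a Prim run starting at `v`, not stopped before its last vertex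
(no intermediate vertex has rank lower than `v`), which terminates either because the
last added vertex `u` satisfies `π u < π v`, or because `v`'s whole component has been
explored (no edge leaves the explored set). -/
def IsStoppedPrim (G : SimpleGraph V) (w : Sym2 V → ℝ) (π : V → ℕ) (v : V)
    (L : List V) : Prop :=
  PrimRun G w L ∧ L.head? = some v ∧ (∀ u ∈ L.dropLast, π v ≤ π u) ∧
    ((∃ u : V, L.getLast? = some u ∧ π u < π v) ∨
      ∀ y ∈ L, ∀ z : V, G.Adj y z → z ∈ L)

theorem aux_delete_reach {V : Type*} {T : SimpleGraph V} {y z : V} {a b : V}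
    (p : T.Walk a b) (hb : b = y) :
    (T.deleteEdges {s(y, z)}).Reachable a y ∨ (T.deleteEdges {s(y, z)}).Reachable a z := by
  induction p with
  | nil => subst hb; exact Or.inl (Reachable.refl _)
  | @cons a c b h p ih =>
    by_cases he : s(a, c) = s(y, z)
    · rw [Sym2.eq_iff] at he
      rcases he with ⟨rfl, rfl⟩ | ⟨rfl, rfl⟩
      · exact Or.inl (Reachable.refl _)
      · exact Or.inr (Reachable.refl _)
    · have hadj : (T.deleteEdges {s(y, z)}).Adj a c := by
        rw [deleteEdges_adj]; exact ⟨h, he⟩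
      rcases ih hb with h1 | h1
      · exact Or.inl (hadj.reachable.trans h1)
      · exact Or.inr (hadj.reachable.trans h1)

theorem aux_cut {V : Type*} [Fintype V] [DecidableEq V] {G T : SimpleGraph V}
    {w : Sym2 V → ℝ} (hG : G.Connected) (hw : DistinctWeights G w) (hT : IsMSF G w T)
    {S : Set V} {x u : V} (hx : x ∈ S) (hu : u ∉ S) (hxu : G.Adj x u)
    (hmin : ∀ y ∈ S, ∀ z : V, z ∉ S → G.Adj y z → w s(x, u) ≤ w s(y, z)) :
    T.Adj x u := by
  classical
  by_contra hn
  obtain ⟨⟨hle, hac, hre⟩, hopt⟩ := hT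
  have hTr : ∀ a b, T.Reachable a b := fun a b => (hre a b).2 (hG.preconnected a b)
  obtain ⟨p, hp⟩ := (hTr x u).exists_isPath
  obtain ⟨⟨⟨y, z⟩, hyz⟩, hd, hy, hz⟩ := p.exists_boundary_dart S hx hu
  simp only at hy hz hyz
  have hmem : s(y, z) ∈ p.edges := by
    rw [Walk.edges, List.mem_map]
    exact ⟨_, hd, rfl⟩
  have hne : s(x, u) ≠ s(y, z) := by
    intro h
    apply hn
    rw [← mem_edgeSet, h]; exact hyz
  have hlt : w s(x, u) < w s(y, z) := by
    refine lt_of_le_of_ne (hmin y hy z hz (hle hyz)) fun h => hne ?_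
    exact hw _ hxu _ (hle hyz) h
  have hD : T.deleteEdges {s(y, z)} ≤ T := deleteEdges_le _
  have hnr : ¬ (T.deleteEdges {s(y, z)}).Reachable x u := by
    intro h
    obtain ⟨q, hq⟩ := h.exists_isPath
    have h1 := hac.path_unique ⟨p, hp⟩ ⟨q.mapLe hD, hq.mapLe hD⟩
    have h2 : p = q.mapLe hD := congrArg Subtype.val h1
    rw [h2, Walk.edges_mapLe_eq_edges] at hmem
    have := q.edges_subset_edgeSet hmem
    rw [edgeSet_deleteEdges] at this
    exact this.2 rfl
  set D := T.deleteEdges {s(y, z)} with hDdef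
  have hside : ∀ a, D.Reachable a y ∨ D.Reachable a z := fun a =>
    aux_delete_reach (hTr a y).some rfl
  set F := D ⊔ edge x u with hF
  have hDF : D ≤ F := le_sup_left
  have hxuF : F.Reachable x u := by
    apply Adj.reachable
    exact Or.inr ((edge_adj _ _ _ _).2 ⟨Or.inl ⟨rfl, rfl⟩, hxu.ne⟩)
  have hyzF : F.Reachable y z := by
    rcases hside x with h1 | h1 <;> rcases hside u with h2 | h2
    · exact absurd (h1.trans h2.symm) hnr
    · exact ((h1.symm.mono hDF).trans hxuF).trans (h2.mono hDF)
    · exact ((h2.symm.mono hDF).trans hxuF.symm).trans (h1.mono hDF)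
    · exact absurd (h1.trans h2.symm) hnr
  have hFy : ∀ a, F.Reachable a y := by
    intro a
    rcases hside a with h | h
    · exact h.mono hDF
    · exact (h.mono hDF).trans hyzF.symm
  have hspan : IsSpanningForest G F := by
    refine ⟨sup_le (hD.trans hle) ?_, ?_, fun a b => ⟨fun _ => hG.preconnected a b,
      fun _ => (hFy a).trans (hFy b).symm⟩⟩
    · intro a b hab
      rw [edge_adj] at hab
      rcases hab.1 with ⟨rfl, rfl⟩ | ⟨rfl, rfl⟩
      · exact hxu
      · exact hxu.symm
    · exact (hac.anti hD).sup_edge_of_not_reachable hnr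
  have hEF : ∀ e, e ∈ F.edgeSet ↔ (e ∈ T.edgeSet ∧ e ≠ s(y, z)) ∨ e = s(x, u) := by
    intro e
    rw [hF, edgeSet_sup, hDdef, edgeSet_deleteEdges, edge, edgeSet_fromEdgeSet]
    have hnd : s(x, u) ∉ Sym2.diagSet := by simp [hxu.ne]
    simp only [Set.mem_union, Set.mem_sdiff, Set.mem_singleton_iff]
    refine or_congr Iff.rfl ⟨fun h => h.1, fun h => ⟨h, h ▸ hnd⟩⟩
  have hsum : weightSum F w = weightSum T w - w s(y, z) + w s(x, u) := by
    have h1 : weightSum F w = ∑ e : Sym2 V, ((if e ∈ T.edgeSet then w e else 0)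
        - (if e = s(y, z) then w e else 0) + (if e = s(x, u) then w e else 0)) := by
      unfold weightSum
      refine Finset.sum_congr rfl fun e _ => ?_
      have hyT : s(y, z) ∈ T.edgeSet := hyz
      have hxT : s(x, u) ∉ T.edgeSet := hn
      simp only [hEF]
      by_cases h2 : e = s(x, u)
      · subst h2; simp [hxT, hne]
      · by_cases h3 : e = s(y, z)
        · subst h3; simp [hyT, hne.symm]
        · simp [h2, h3]
    rw [h1, Finset.sum_add_distrib, Finset.sum_sub_distrib]
    simp [weightSum]
  have := hopt F hspan
  linarith

theorem aux_self_mem {V : Type*} (R : RTree V) (v : V) : v ∈ R.subtree v := ⟨0, rfl⟩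

theorem aux_closed {V : Type*} {T : SimpleGraph V} {π : V → ℕ} {R : RTree V}
    (hπ : Function.Injective π) (hR : IsThreep T π R) (k : ℕ) :
    ∀ v, R.parent^[k] v = R.root → ∀ a ∈ R.subtree v, ∀ b, T.Adj a b → π v ≤ π b →
      b ∈ R.subtree v := by
  induction k with
  | zero =>
    intro v hv a _ b _ _
    have hv' : v = R.root := hv
    subst hv'
    exact R.reaches_root b
  | succ k ih =>
    intro v hv a ha b hab hb
    rw [Function.iterate_succ_apply] at hv
    by_cases hpv : R.parent v = v
    · rw [hpv] at hv
      exact ih v hv a ha b hab hb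
    have hvp : v ∈ R.subtree (R.parent v) := ⟨1, rfl⟩
    have hlt : π (R.parent v) < π v :=
      lt_of_le_of_ne (hR.1 _ _ hvp) fun h => hpv (hπ h)
    have hap : a ∈ R.subtree (R.parent v) := by
      obtain ⟨j, hj⟩ := ha
      exact ⟨j + 1, by rw [Function.iterate_succ_apply', hj]⟩
    have hbp := ih _ hv a hap b hab (by omega)
    have hbne : b ≠ R.parent v := by rintro rfl; omega
    have hmem : R.subtree v ∈ childSubtrees R (R.parent v) :=
      ⟨v, rfl, fun h => hpv h.symm, rfl⟩
    rw [hR.2] at hmem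
    obtain ⟨c, _, hEq⟩ := hmem
    rw [hEq] at ha ⊢
    obtain ⟨q, hq⟩ := ha
    refine ⟨q.concat hab, fun t ht => ?_⟩
    rw [Walk.support_concat, List.mem_append] at ht
    rcases ht with ht | ht
    · exact hq t ht
    · rw [List.mem_singleton] at ht
      subst ht
      exact ⟨hbp, hbne⟩

theorem aux_nodup {V : Type*} {G : SimpleGraph V} {w : Sym2 V → ℝ} {L : List V}
    (h : PrimRun G w L) : L.Nodup ∧ L ≠ [] := by
  induction h with
  | single v => simp
  | @step L u _ hs ih =>
    refine ⟨?_, by simp⟩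
    rw [List.nodup_append]
    refine ⟨ih.1, by simp, fun a ha b hb => ?_⟩
    rw [List.mem_singleton] at hb
    subst hb
    rintro rfl
    exact hs.1 ha

theorem aux_run {V : Type*} {G T : SimpleGraph V} {w : Sym2 V → ℝ} {π : V → ℕ} {R : RTree V}
    {v : V}
    (hcut : ∀ (S : Set V) (x u : V), x ∈ S → u ∉ S → G.Adj x u →
      (∀ y ∈ S, ∀ z : V, z ∉ S → G.Adj y z → w s(x, u) ≤ w s(y, z)) → T.Adj x u)
    (hcl : ∀ a ∈ R.subtree v, ∀ b, T.Adj a b → π v ≤ π b → b ∈ R.subtree v)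
    {L : List V} (h : PrimRun G w L) (hv : L.head? = some v)
    (hd : ∀ u ∈ L.dropLast, π v ≤ π u) : ∀ u ∈ L, π v ≤ π u → u ∈ R.subtree v := by
  induction h with
  | single a =>
    intro u hu _
    simp only [List.head?_cons, Option.some.injEq] at hv
    simp only [List.mem_singleton] at hu
    subst hv; subst hu
    exact aux_self_mem R _
  | @step L u hL hs ih =>
    have hne := (aux_nodup hL).2
    rw [List.head?_append_of_ne_nil _ hne] at hv
    rw [List.dropLast_concat] at hd
    have ih' := ih hv fun t ht => hd t (List.dropLast_subset _ ht)
    intro t ht htv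
    rw [List.mem_append, List.mem_singleton] at ht
    rcases ht with ht | rfl
    · exact ih' t ht htv
    · obtain ⟨hu, x, hx, hxu, hm⟩ := hs
      exact hcl x (ih' x hx (hd x hx)) t (hcut _ x t hx hu hxu hm) htv

/-- Let `G` be connected with distinct edge weights and maximum degree at most 3, let
`T` be its minimum spanning tree and `R` the threep of `(T, π)`. Then every vertex
visited by the Prim search from `v` (other than possibly the final lower-rank vertex)
lies in the subtree `R_v`, and the number of queries made by the search (one per
explored vertex) is at most `C·|R_v|` for an absolute constant `C`. -/
theorem prim_search_in_threep_subtree :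
    ∃ C : ℝ, 0 < C ∧
      ∀ (V : Type) [Fintype V] [DecidableEq V] (G T : SimpleGraph V)
        (w : Sym2 V → ℝ) (π : V → ℕ) (R : RTree V),
        G.Connected → DistinctWeights G w → MaxDegLE G 3 →
        Function.Injective π → IsMSF G w T → IsThreep T π R →
        ∀ (v : V) (L : List V), IsStoppedPrim G w π v L →
          (∀ u ∈ L, π v ≤ π u → u ∈ R.subtree v) ∧
          (L.length : ℝ) ≤ C * ((R.subtree v).ncard : ℝ) := by
  refine ⟨2, by norm_num, ?_⟩
  intro V _ _ G T w π R hG hw _ hπ hT hR v L ⟨hL, hhead, hdrop, _⟩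
  obtain ⟨k, hk⟩ := R.reaches_root v
  have h1 := aux_run (fun S x u hx hu hxu hm => aux_cut hG hw hT hx hu hxu hm)
    (aux_closed hπ hR k v hk) hL hhead hdrop
  refine ⟨h1, ?_⟩
  obtain ⟨hnd, hne⟩ := aux_nodup hL
  have hsub : (L.dropLast.toFinset : Set V) ⊆ R.subtree v := by
    intro t ht
    have ht' : t ∈ L.dropLast := by simpa using ht
    exact h1 t (List.dropLast_subset _ ht') (hdrop t ht')
  have hcard := Set.ncard_le_ncard hsub (Set.toFinite _)
  rw [Set.ncard_coe_finset, List.toFinset_card_of_nodup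
    (hnd.sublist (List.dropLast_sublist L)), List.length_dropLast] at hcard
  have hpos : 0 < (R.subtree v).ncard :=
    (Set.ncard_pos (Set.toFinite _)).2 ⟨v, aux_self_mem R v⟩
  have : L.length ≤ 2 * (R.subtree v).ncard := by omega
  exact_mod_cast this
end

section
/- Let G be an undirected graph with an injective priority function π on its vertices. Define the peeling process: H₁ = G; in phase i, let L_i be the set of vertices of H_i whose priority is smaller than the priority of all of their neighbors in H_i, and let H_{i+1} be obtained from H_i by removing the vertices of L_i together with all their neighbors (and incident edges). Then the process terminates with an empty graph after finitely many phases, and the union of the sets L_i over all phases equals the lexicographically-first maximal independent set LFMIS(G, π). -/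
open SimpleGraph

variable {V : Type*} [DecidableEq V]

/-- One step of the greedy MIS algorithm: add `v` to the independent set `I` iff no
vertex already chosen is adjacent to `v`. -/
def greedyStep (G : SimpleGraph V) [DecidableRel G.Adj] (I : Finset V) (v : V) :
    Finset V :=
  if ∀ u ∈ I, ¬ G.Adj u v then insert v I else I

/-- The lexicographically-first maximal independent set of `G` obtained by processing
the vertices in the order given by the list `order`. -/
def LFMIS (G : SimpleGraph V) [DecidableRel G.Adj] (order : List V) : Finset V :=
  order.foldl (greedyStep G) ∅

/-- The local minima of the subgraph of `G` induced by `S`: vertices of `S` whose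
priority is smaller than that of all their neighbors in `S`. -/
def localMin (G : SimpleGraph V) (π : V → ℕ) (S : Set V) : Set V :=
  {v | v ∈ S ∧ ∀ u ∈ S, G.Adj v u → π v < π u}

/-- The vertex sets of the peeling process: `H₁ = G` (here `peelS G π 0 = univ`), and in
each phase the local minima together with all their neighbors are removed. -/
def peelS (G : SimpleGraph V) (π : V → ℕ) : ℕ → Set V
  | 0 => Set.univ
  | i + 1 =>
      peelS G π i \
        (localMin G π (peelS G π i) ∪
          {u | ∃ v ∈ localMin G π (peelS G π i), G.Adj v u})

theorem aux_foldl (G : SimpleGraph V) [DecidableRel G.Adj] (π : V → ℕ) :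
    ∀ (l : List V) (I : Finset V), l.Pairwise (fun a b => π a < π b) →
      (∀ u ∈ I, ∀ w ∈ l, π u < π w) → ∀ v : V,
      (v ∈ l.foldl (greedyStep G) I ↔
        v ∈ I ∨ (v ∈ l ∧ ∀ u ∈ l.foldl (greedyStep G) I, G.Adj u v → ¬ π u < π v)) := by
  intro l
  induction l with
  | nil => intro I _ _ v; simp
  | cons a t ih =>
    intro I hs hI v
    rw [List.pairwise_cons] at hs
    obtain ⟨ha, ht⟩ := hs
    have hsub : ∀ x, x ∈ greedyStep G I a ↔ x ∈ I ∨ (x = a ∧ ∀ u ∈ I, ¬ G.Adj u a) := by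
      intro x
      unfold greedyStep
      split_ifs with h
      · rw [Finset.mem_insert]; tauto
      · tauto
    have hI' : ∀ u ∈ greedyStep G I a, ∀ w ∈ t, π u < π w := by
      intro u hu w hw
      rcases (hsub u).1 hu with h | ⟨rfl, _⟩
      · exact hI u h w (List.mem_cons_of_mem _ hw)
      · exact ha w hw
    have key := ih (greedyStep G I a) ht hI'
    rw [List.foldl_cons]
    generalize t.foldl (greedyStep G) (greedyStep G I a) = R at key
    have hIR : ∀ u, u ∈ I → u ∈ R := fun u hu => (key u).2 (Or.inl ((hsub u).2 (Or.inl hu)))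
    have hRI : ∀ u ∈ R, π u < π a → u ∈ I := by
      intro u hu hlt
      rcases (key u).1 hu with h | ⟨h, _⟩
      · rcases (hsub u).1 h with h | ⟨rfl, _⟩
        · exact h
        · exact absurd hlt (lt_irrefl _)
      · exact absurd hlt (ha u h).asymm
    rw [key v, hsub v, List.mem_cons]
    constructor
    · rintro ((h | ⟨rfl, h⟩) | ⟨h, h2⟩)
      · exact Or.inl h
      · exact Or.inr ⟨Or.inl rfl, fun u hu hadj hlt => h u (hRI u hu hlt) hadj⟩
      · exact Or.inr ⟨Or.inr h, h2⟩
    · rintro (h | ⟨rfl | h, h2⟩)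
      · exact Or.inl (Or.inl h)
      · exact Or.inl (Or.inr ⟨rfl, fun u hu hadj =>
          h2 u (hIR u hu) hadj (hI u hu v List.mem_cons_self)⟩)
      · exact Or.inr ⟨h, h2⟩

theorem aux_anti (G : SimpleGraph V) (π : V → ℕ) : Antitone (peelS G π) :=
  antitone_nat_of_succ_le fun _ => Set.sdiff_subset

theorem aux_term [Fintype V] (G : SimpleGraph V) (π : V → ℕ) (hπ : Function.Injective π) :
    ∃ k : ℕ, peelS G π k = ∅ := by
  by_contra hne
  push Not at hne
  have hstep : ∀ i, (peelS G π (i + 1)).ncard < (peelS G π i).ncard := by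
    intro i
    apply Set.ncard_lt_ncard _ (Set.toFinite _)
    refine ⟨Set.sdiff_subset, fun hsub => ?_⟩
    obtain ⟨v, hv, hmin⟩ := Set.exists_min_image (peelS G π i) π (Set.toFinite _) (hne i)
    have hL : v ∈ localMin G π (peelS G π i) := by
      refine ⟨hv, fun u hu hadj => lt_of_le_of_ne (hmin u hu) fun h => ?_⟩
      exact hadj.ne (hπ h)
    exact (hsub hv).2 (Or.inl hL)
  exact not_strictAnti_of_wellFoundedLT (fun i => (peelS G π i).ncard) (strictAnti_nat_of_succ_lt hstep)

theorem aux_peel [Fintype V] (G : SimpleGraph V) (π : V → ℕ) (hπ : Function.Injective π)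
    (v : V) : (v ∈ ⋃ i : ℕ, localMin G π (peelS G π i)) ↔
      ∀ u ∈ ⋃ i : ℕ, localMin G π (peelS G π i), G.Adj u v → ¬ π u < π v := by
  constructor
  · intro hv u hu hadj hlt
    obtain ⟨i, hi⟩ := Set.mem_iUnion.1 hv
    obtain ⟨j, hj⟩ := Set.mem_iUnion.1 hu
    rcases le_or_gt i j with h | h
    · exact (hi.2 u (aux_anti G π h hj.1) hadj.symm).asymm hlt
    · exact (aux_anti G π (Nat.succ_le_of_lt h) hi.1).2 (Or.inr ⟨u, hj, hadj⟩)
  · intro h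
    by_contra hv
    obtain ⟨k, hk⟩ := aux_term G π hπ
    have hall : ∀ i, v ∈ peelS G π i := by
      intro i
      induction i with
      | zero => exact Set.mem_univ v
      | succ i ih =>
        refine ⟨ih, ?_⟩
        rintro (h1 | ⟨u, hu, hadj⟩)
        · exact hv (Set.mem_iUnion.2 ⟨i, h1⟩)
        · exact h u (Set.mem_iUnion.2 ⟨i, hu⟩) hadj (hu.2 v ih hadj)
    have := hall k
    rw [hk] at this
    exact this

/-- The peeling process terminates with the empty graph after finitely many phases, and
the union of the sets of local minima over all phases equals the lexicographically-first
maximal independent set of `G` for the priorities `π`. -/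
theorem peeling_computes_LFMIS [Fintype V] (G : SimpleGraph V) [DecidableRel G.Adj]
    (π : V → ℕ) (hπ : Function.Injective π) (order : List V)
    (hmem : ∀ v : V, v ∈ order)
    (hsorted : order.Pairwise fun a b => π a < π b) :
    (∃ k : ℕ, peelS G π k = ∅) ∧
    (⋃ i : ℕ, localMin G π (peelS G π i)) = ↑(LFMIS G order) := by
  refine ⟨aux_term G π hπ, ?_⟩
  have hM : ∀ v, v ∈ LFMIS G order ↔ ∀ u ∈ LFMIS G order, G.Adj u v → ¬ π u < π v := by
    intro v
    have := aux_foldl G π order ∅ hsorted (by simp) v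
    simp only [Finset.notMem_empty, false_or, hmem v, true_and] at this
    exact this
  have hU := aux_peel G π hπ
  have main : ∀ n : ℕ, ∀ v, π v = n →
      ((v ∈ ⋃ i : ℕ, localMin G π (peelS G π i)) ↔ v ∈ LFMIS G order) := by
    intro n
    induction n using Nat.strong_induction_on with
    | _ n ih =>
      intro v hv
      rw [hU v, hM v]
      constructor
      · intro h u hu hadj hlt
        exact h u ((ih (π u) (hv ▸ hlt) u rfl).2 hu) hadj hlt
      · intro h u hu hadj hlt
        exact h u ((ih (π u) (hv ▸ hlt) u rfl).1 hu) hadj hlt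
  ext v
  rw [main (π v) v rfl, Finset.mem_coe]
end
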